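/- Let n ≥ 4 be even. There is no permutation σ of {1,…,n} whose cycle type is (n/2, n/2) (i.e., σ is a product of two disjoint cycles each of length n/2) such that the longest increasing subsequence of σ has length n−2 and the longest decreasing subsequence of σ has length 3. -/

import Mathlib

open Equiv

/-- `s` is (the index set of) an increasing subsequence of the permutation `σ`. -/
def IsIncSubseq {n : ℕ} (σ : Perm (Fin n)) (s : Finset (Fin n)) : Prop :=
  ∀ i ∈ s, ∀ j ∈ s, i < j → σ i < σ j

/-- `s` is (the index set of) a decreasing subsequence of the permutation `σ`. -/
def IsDecSubseq {n : ℕ} (σ : Perm (Fin n)) (s : Finset (Fin n)) : Prop :=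
  ∀ i ∈ s, ∀ j ∈ s, i < j → σ j < σ i

/-- The cycle type of `σ`, counting each fixed point as a cycle of length `1`. -/
def fullCycleType {n : ℕ} (σ : Perm (Fin n)) : Multiset ℕ :=
  σ.cycleType + Multiset.replicate (n - σ.cycleType.sum) 1

/-- If `σ` is increasing off `{a, b}`, then the rank of any other index `i` and of its value `σ i`
agree after discarding `a, b` and `σ a, σ b` respectively. -/
lemma val_add_eq_of_inc_off_pair {n : ℕ} (σ : Perm (Fin n)) (a b : Fin n) (hab : a ≠ b)
    (h : ∀ i j, i ≠ a → i ≠ b → j ≠ a → j ≠ b → i < j → σ i < σ j)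
    (i : Fin n) (hia : i ≠ a) (hib : i ≠ b) :
    (σ i : ℕ) + (if a < i then 1 else 0) + (if b < i then 1 else 0) =
      i + (if σ a < σ i then 1 else 0) + (if σ b < σ i then 1 else 0) := by
  have hcount (k : Fin n) : ∑ j : Fin n, (if j < k then (1 : ℤ) else 0) = k := by
    rw [Finset.sum_boole, Finset.filter_gt_eq_Iio, Fin.card_Iio]
  have hcount' : ∑ j : Fin n, (if σ j < σ i then (1 : ℤ) else 0) = σ i := by
    rw [← hcount (σ i)]
    exact Equiv.sum_comp σ (fun j => if j < σ i then (1 : ℤ) else 0)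
  have hsum : ∑ j ∈ {a, b}, ((if σ j < σ i then (1 : ℤ) else 0) - (if j < i then 1 else 0)) =
      ∑ j : Fin n, ((if σ j < σ i then (1 : ℤ) else 0) - (if j < i then 1 else 0)) := by
    refine Finset.sum_subset (Finset.subset_univ _) fun j _ hj => ?_
    simp only [Finset.mem_insert, Finset.mem_singleton, not_or] at hj
    have hiff : σ j < σ i ↔ j < i := by
      refine ⟨fun hlt => ?_, h j i hj.1 hj.2 hia hib⟩
      by_contra hle
      rcases (not_lt.mp hle).eq_or_lt with rfl | hlt'
      · exact lt_irrefl _ hlt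
      · exact lt_asymm hlt (h i j hia hib hj.1 hj.2 hlt')
    simp [hiff]
  rw [Finset.sum_pair hab, Finset.sum_sub_distrib, hcount, hcount'] at hsum
  split_ifs at hsum ⊢ <;> omega

/-- If `σ` sends `a = 0` to `n - 1` and is increasing off `{a, b}` with `b < σ b`, then no invariant
set avoiding `a` contains exactly half of the points. -/
lemma not_invariant_half {n : ℕ} (σ : Perm (Fin n)) (a b : Fin n) (ha : (a : ℕ) = 0)
    (hσa : (σ a : ℕ) + 1 = n) (hb : b < σ b) (hba : b ≠ a)
    (h : ∀ i, i ≠ a → i ≠ b →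
      (σ i : ℕ) + (if a < i then 1 else 0) + (if b < i then 1 else 0) =
        i + (if σ a < σ i then 1 else 0) + (if σ b < σ i then 1 else 0))
    (D : Finset (Fin n)) (hD : ∀ i, σ i ∈ D ↔ i ∈ D) (haD : a ∉ D) (hcard : 2 * D.card = n) :
    False := by
  have hstep (i : Fin n) (hia : i ≠ a) (hib : i ≠ b) :
      (σ i : ℕ) + 1 + (if b < i then 1 else 0) = i + (if σ b < σ i then 1 else 0) := by
    have := h i hia hib
    split_ifs at this ⊢ <;> omega
  have hlow (k : ℕ) : ∀ i : Fin n, (i : ℕ) = k → i < b → i ∉ D := by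
    induction k with
    | zero =>
      intro i hi _
      rwa [show i = a by omega]
    | succ k ih =>
      intro i hi hib
      have hs := hstep i (by omega) (by omega)
      rw [← hD]
      apply ih <;> split_ifs at hs <;> omega
  have hhigh (k : ℕ) : ∀ i : Fin n, (i : ℕ) + 1 + k = n → σ b < i → i ∉ D := by
    induction k with
    | zero =>
      intro i hi _
      rwa [show i = σ a by omega, hD]
    | succ k ih =>
      intro i hi hib
      obtain ⟨j, hj⟩ : ∃ j : Fin n, (j : ℕ) = i + 1 := ⟨⟨i + 1, by omega⟩, rfl⟩
      have hjb : j ≠ b := by omega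
      have hs := hstep j (by omega) hjb
      have hne : σ j ≠ σ b := σ.injective.ne hjb
      have hji : σ j = i := by split_ifs at hs <;> omega
      rw [← hji, hD]
      exact ih j (by omega) (by omega)
  have hdrop : ∀ i ∈ D, i ≠ b → (i : ℤ) - σ i = 2 := by
    intro i hi hib
    have hbi : ¬ i < b := fun hlt => hlow _ i rfl hlt hi
    have hiq : ¬ σ b < i := fun hlt => hhigh (n - (i + 1)) i (by omega) hlt hi
    have hs := hstep i (by rintro rfl; exact haD hi) hib
    split_ifs at hs <;> omega
  have hsum : ∑ i ∈ D, ((i : ℤ) - σ i) = 0 := by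
    rw [Finset.sum_sub_distrib, sub_eq_zero]
    refine (Finset.sum_nbij σ (fun i hi => (hD i).2 hi) σ.injective.injOn
      (fun i hi => ⟨σ.symm i, ?_, by simp⟩) (fun _ _ => rfl)).symm
    have := hD (σ.symm i)
    rw [Equiv.apply_symm_apply] at this
    exact this.1 hi
  have hneb : σ b ≠ σ a := σ.injective.ne hba
  by_cases hbD : b ∈ D
  · rw [← Finset.add_sum_erase _ _ hbD, Finset.sum_congr rfl fun i hi =>
      hdrop i (Finset.mem_of_mem_erase hi) (Finset.ne_of_mem_erase hi), Finset.sum_const,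
      Finset.card_erase_of_mem hbD, nsmul_eq_mul] at hsum
    have := Finset.card_pos.2 ⟨b, hbD⟩
    omega
  · rw [Finset.sum_congr rfl fun i hi => hdrop i hi (by rintro rfl; exact hbD hi),
      Finset.sum_const, nsmul_eq_mul] at hsum
    omega

/-- A permutation of cycle type `(n/2, n/2)` has no fixed point when `n ≥ 4`, and each point is
missed by an invariant set of half the points. -/
lemma fixedPointFree_and_exists_invariant_half {n : ℕ} (hn : 4 ≤ n) (heven : 2 ∣ n)
    (σ : Perm (Fin n)) (hσ : fullCycleType σ = {n / 2, n / 2}) :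
    (∀ i, σ i ≠ i) ∧
      ∀ x, ∃ D : Finset (Fin n), (∀ i, σ i ∈ D ↔ i ∈ D) ∧ x ∉ D ∧ 2 * D.card = n := by
  have hzero : n - σ.cycleType.sum = 0 := by
    by_contra hne
    have hmem : 1 ∈ fullCycleType σ :=
      Multiset.mem_add.2 (Or.inr (Multiset.mem_replicate.2 ⟨hne, rfl⟩))
    rw [hσ] at hmem
    simp only [Multiset.insert_eq_cons, Multiset.mem_cons, Multiset.mem_singleton] at hmem
    omega
  have htype : σ.cycleType = {n / 2, n / 2} := by
    simpa [fullCycleType, hzero] using hσ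
  have hsupp : σ.support = Finset.univ := by
    rw [← Finset.card_eq_iff_eq_univ, ← Perm.sum_cycleType, htype]
    simp
    omega
  have hfix (i : Fin n) : σ i ≠ i := by
    rw [← Perm.mem_support, hsupp]
    exact Finset.mem_univ i
  refine ⟨hfix, fun x => ⟨(σ.cycleOf x).supportᶜ, fun i => ?_, ?_, ?_⟩⟩
  · simp [Perm.mem_support_cycleOf_iff' (hfix x)]
  · simp [Perm.mem_support_cycleOf_iff' (hfix x), Perm.SameCycle.refl]
  · have hmem : (σ.cycleOf x).support.card ∈ σ.cycleType := by
      rw [Perm.cycleType_def]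
      exact Multiset.mem_map_of_mem (Finset.card ∘ Perm.support) (Finset.mem_def.1 <|
        Perm.cycleOf_mem_cycleFactorsFinset_iff.2 (Perm.mem_support.2 (hfix x)))
    rw [htype] at hmem
    simp only [Multiset.insert_eq_cons, Multiset.mem_cons, Multiset.mem_singleton, or_self] at hmem
    rw [Finset.card_compl, hmem, Fintype.card_fin]
    omega

/-- If an increasing subsequence omits two indices and there is a decreasing subsequence of
length three, then the latter consists of the two omitted indices and a third one. -/
lemma exists_pair_of_inc_of_dec {n : ℕ} (hn : 2 ≤ n) (σ : Perm (Fin n)) (s t : Finset (Fin n))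
    (hs : IsIncSubseq σ s) (hscard : s.card = n - 2) (ht : IsDecSubseq σ t) (htcard : t.card = 3) :
    ∃ a b c, a < b ∧ c ≠ a ∧ c ≠ b ∧ IsDecSubseq σ {a, b, c} ∧
      ∀ i j, i ≠ a → i ≠ b → j ≠ a → j ≠ b → i < j → σ i < σ j := by
  have hcompl : sᶜ.card = 2 := by
    rw [Finset.card_compl, Fintype.card_fin]
    omega
  have hinter : (t ∩ s).card ≤ 1 := by
    refine Finset.card_le_one.2 fun i hi j hj => ?_
    simp only [Finset.mem_inter] at hi hj
    rcases lt_trichotomy i j with hlt | heq | hlt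
    · exact absurd (hs i hi.2 j hj.2 hlt) (ht i hi.1 j hj.1 hlt).asymm
    · exact heq
    · exact absurd (hs j hj.2 i hi.2 hlt) (ht j hj.1 i hi.1 hlt).asymm
  have hsplit := Finset.card_inter_add_card_sdiff t s
  have hsub : t \ s ⊆ sᶜ := fun i hi => by simpa using (Finset.mem_sdiff.1 hi).2
  have heq : t \ s = sᶜ := Finset.eq_of_subset_of_card_le hsub (by omega)
  have hone : (t ∩ s).card = 1 := by
    rw [heq] at hsplit
    omega
  obtain ⟨c, hc⟩ := Finset.card_eq_one.1 hone
  obtain ⟨a, b, hab, hpair⟩ : ∃ a b, a < b ∧ sᶜ = {a, b} := by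
    obtain ⟨a, b, hne, h⟩ := Finset.card_eq_two.1 hcompl
    rcases hne.lt_or_gt with hlt | hlt
    · exact ⟨a, b, hlt, h⟩
    · exact ⟨b, a, hlt, h.trans (Finset.pair_comm a b)⟩
  have hmem (i : Fin n) : i ∈ s ↔ i ≠ a ∧ i ≠ b := by
    rw [← not_iff_not, ← Finset.mem_compl, hpair, Finset.mem_insert, Finset.mem_singleton]
    tauto
  have hct : c ∈ t ∩ s := by simp [hc]
  have hcs := (hmem c).1 (Finset.mem_inter.1 hct).2
  have hts : ({a, b, c} : Finset (Fin n)) ⊆ t := by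
    have hst : sᶜ ⊆ t := heq ▸ Finset.sdiff_subset
    rw [hpair] at hst
    intro i hi
    simp only [Finset.mem_insert, Finset.mem_singleton] at hi
    rcases hi with rfl | rfl | rfl
    · exact hst (by simp)
    · exact hst (by simp)
    · exact (Finset.mem_inter.1 hct).1
  exact ⟨a, b, c, hab, hcs.1, hcs.2, fun i hi j hj => ht i (hts hi) j (hts hj),
    fun i j hia hib hja hjb => hs i ((hmem i).2 ⟨hia, hib⟩) j ((hmem j).2 ⟨hja, hjb⟩)⟩

/-- For even `n ≥ 4`, no permutation of `{1,…,n}` with cycle type `(n/2, n/2)`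
has longest increasing subsequence of length `n - 2` and longest decreasing
subsequence of length `3`. -/
theorem no_perm_cycleType_half_half_shape_n_sub_two_one_one
    (n : ℕ) (hn : 4 ≤ n) (heven : 2 ∣ n) :
    ¬ ∃ σ : Perm (Fin n),
      fullCycleType σ = {n / 2, n / 2} ∧
      ((∃ s, IsIncSubseq σ s ∧ s.card = n - 2) ∧
        (∀ s, IsIncSubseq σ s → s.card ≤ n - 2)) ∧
      ((∃ s, IsDecSubseq σ s ∧ s.card = 3) ∧
        (∀ s, IsDecSubseq σ s → s.card ≤ 3)) := by
  rintro ⟨σ, hσ, ⟨⟨s, hs, hscard⟩, -⟩, ⟨t, ht, htcard⟩, -⟩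
  obtain ⟨hfix, hinv⟩ := fixedPointFree_and_exists_invariant_half hn heven σ hσ
  obtain ⟨a, b, c, hab, hca, hcb, hdec, hinc⟩ :=
    exists_pair_of_inc_of_dec (by omega) σ s t hs hscard ht htcard
  have hrank := val_add_eq_of_inc_off_pair σ a b hab.ne hinc
  have hσab : σ b < σ a := hdec a (by simp) b (by simp) hab
  have hfirst : (a : ℕ) = 0 ∨ (σ b : ℕ) = 0 := by
    obtain ⟨i, hi⟩ : ∃ i : Fin n, (i : ℕ) = 0 := ⟨⟨0, by omega⟩, rfl⟩
    by_contra! hne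
    have := hrank i (by omega) (by omega)
    have := hfix i
    split_ifs at * <;> omega
  have hlast : (b : ℕ) + 1 = n ∨ (σ a : ℕ) + 1 = n := by
    obtain ⟨i, hi⟩ : ∃ i : Fin n, (i : ℕ) + 1 = n := ⟨⟨n - 1, by omega⟩, by simp; omega⟩
    by_contra! hne
    have := hrank i (by omega) (by omega)
    have := hfix i
    have := σ.injective.ne (show i ≠ a by omega)
    have := σ.injective.ne (show i ≠ b by omega)
    split_ifs at * <;> omega
  have hc : c < a ∧ σ a < σ c ∧ σ a < a ∨ b < c ∧ σ c < σ b ∧ b < σ b := by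
    have h₁ := hdec a (by simp) c (by simp)
    have h₂ := hdec c (by simp) a (by simp)
    have h₃ := hdec b (by simp) c (by simp)
    have h₄ := hdec c (by simp) b (by simp)
    have := hrank c hca hcb
    have := hfix a
    have := hfix b
    have := hfix c
    split_ifs at * <;> omega
  rcases hc with ⟨hca', hcσ, hlt⟩ | ⟨hbc, hcσ, hlt⟩
  · obtain ⟨D, hD, hbD, hcard⟩ := hinv (σ b)
    refine not_invariant_half σ⁻¹ (σ b) (σ a) (by omega) (by simp; omega) (by simpa using hlt)
      hσab.ne' (fun i hia hib => ?_) D (fun i => ?_) hbD hcard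
    · have := hrank (σ⁻¹ i) (by rintro rfl; simp at hib) (by rintro rfl; simp at hia)
      simp only [Perm.coe_inv, apply_symm_apply, symm_apply_apply] at this ⊢
      omega
    · simpa using (hD (σ⁻¹ i)).symm
  · obtain ⟨D, hD, haD, hcard⟩ := hinv a
    exact not_invariant_half σ a b (by omega) (by omega) hlt hab.ne' hrank D hD haD hcard
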